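/- arXiv:2407.10556 — 2 statements merged into one kernel-verified Lean document; each statement's English description precedes it below -/
import Mathlib

section
/- Let G be an equatorial graph with equator q, let C be an isometric cycle of length q in G, and let {L_0, …, L_{q−1}} be the partition of G induced by C. If D is any isometric cycle of length q in G, then D has exactly one vertex in each part L_i, i.e. |V(D) ∩ L_i| = 1 for all i ∈ [0, q−1]. -/
open SimpleGraph

/-- The distance between two indices around a cycle of length `q`. -/
def cycleDist {q : ℕ} (i j : ZMod q) : ℕ := min (i - j).val (j - i).val

/-- `f` lists the vertices (in cyclic order) of an isometric cycle of length `q` in `G`: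
the distance in `G` between any two of its vertices equals their distance along the cycle. -/
def IsIsoCycle {V : Type*} (G : SimpleGraph V) (q : ℕ) (f : ZMod q → V) : Prop :=
  3 ≤ q ∧ ∀ i j : ZMod q, G.dist (f i) (f j) = cycleDist i j

/-- `G` has an isometric cycle of length `q`. -/
def HasIsoCycle {V : Type*} (G : SimpleGraph V) (q : ℕ) : Prop :=
  ∃ f : ZMod q → V, IsIsoCycle G q f

/-- The equator of `G` is `q`: `q` is the length of a longest isometric cycle of `G`
(`0` if `G` has no isometric cycle, e.g. if `G` is acyclic). -/
def IsEquator {V : Type*} (G : SimpleGraph V) (q : ℕ) : Prop :=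
  (HasIsoCycle G q ∨ (q = 0 ∧ ∀ q', ¬ HasIsoCycle G q')) ∧ ∀ q', HasIsoCycle G q' → q' ≤ q

/-- The degree of a vertex, as the cardinality of its neighbor set. -/
noncomputable def ndeg {V : Type*} (G : SimpleGraph V) (v : V) : ℕ := (G.neighborSet v).ncard

/-- `G` has minimum degree `δ`. -/
def HasMinDegree {V : Type*} (G : SimpleGraph V) (δ : ℕ) : Prop :=
  (∀ v, δ ≤ ndeg G v) ∧ ∃ v, ndeg G v = δ

/-- The Moore bound `M(δ, g)`. -/
def mooreBound (δ g : ℕ) : ℕ :=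
  if Odd g then 1 + δ * ∑ i ∈ Finset.range ((g + 1) / 2 - 1), (δ - 1) ^ i
  else 2 + ∑ i ∈ Finset.Icc 1 ((g + 1) / 2 - 1), 2 * (δ - 1) ^ i

/-- The disk of radius `k` around a vertex `u`. -/
def disk {V : Type*} (G : SimpleGraph V) (k : ℕ) (u : V) : Set V := {v | G.dist u v ≤ k}

/-- The disk of radius `k` around an edge `uv`. -/
def edisk {V : Type*} (G : SimpleGraph V) (k : ℕ) (u v : V) : Set V :=
  disk G k u ∪ disk G k v

/-- `G` is an equatorial graph with minimum degree `δ`, girth `g` and equator `q`: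
a finite connected simple graph with girth `g`, minimum degree `δ`, equator `q > 6k + 3`
(where `k = ⌈g/2⌉ - 1`) whose order attains the bound `n = (q/g) · M(δ, g)`. -/
def IsEquatorial {V : Type*} (G : SimpleGraph V) (δ g q : ℕ) : Prop :=
  Finite V ∧ G.Connected ∧ G.girth = g ∧ HasMinDegree G δ ∧ IsEquator G q ∧
    6 * ((g + 1) / 2 - 1) + 3 < q ∧ g * Nat.card V = q * mooreBound δ g

/-- The part `L i` of the partition induced by the isometric cycle `f`:
`L i = D_k(u_{i-k}) ∩ D_k(u_{i+k})`. -/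
def Lpart {V : Type*} (G : SimpleGraph V) (k : ℕ) {q : ℕ} (f : ZMod q → V) (i : ZMod q) :
    Set V :=
  disk G k (f (i - (k : ZMod q))) ∩ disk G k (f (i + (k : ZMod q)))

namespace EquatorialGraph

section Moore

variable {V : Type*} {G : SimpleGraph V}

/-- Two distinct paths with the same ends have total length at least the girth. -/
lemma path_eq_of_length_add_length_lt_girth {u v : V} {p p' : G.Walk u v}
    (hp : p.IsPath) (hp' : p'.IsPath) (hlt : p.length + p'.length < G.girth) : p = p' := by
  classical
  set H : SimpleGraph V := fromEdgeSet {e | e ∈ p.edges ∨ e ∈ p'.edges} with hH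
  have memH : ∀ e : Sym2 V, e ∈ H.edgeSet → e ∈ p.edges ∨ e ∈ p'.edges := by
    intro e he
    rw [hH, edgeSet_fromEdgeSet] at he
    exact he.1
  have hpH : ∀ e ∈ p.edges, e ∈ H.edgeSet := fun e he => by
    rw [hH, edgeSet_fromEdgeSet]
    exact ⟨Or.inl he, G.not_isDiag_of_mem_edgeSet (p.edges_subset_edgeSet he)⟩
  have hpH' : ∀ e ∈ p'.edges, e ∈ H.edgeSet := fun e he => by
    rw [hH, edgeSet_fromEdgeSet]
    exact ⟨Or.inr he, G.not_isDiag_of_mem_edgeSet (p'.edges_subset_edgeSet he)⟩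
  have hHG : H ≤ G := by
    rw [← edgeSet_subset_edgeSet]
    intro e he
    rcases memH e he with h | h
    exacts [p.edges_subset_edgeSet h, p'.edges_subset_edgeSet h]
  have hac : H.IsAcyclic := by
    intro x c hc
    have hsub : c.edges ⊆ p.edges ++ p'.edges := fun e he =>
      List.mem_append.2 (memH e (c.edges_subset_edgeSet he))
    have hle := (hc.edges_nodup.subperm hsub).length_le
    have hg := girth_le_length (hc.mapLe hHG)
    simp only [List.length_append, Walk.length_edges, Walk.length_mapLe] at hle hg
    omega
  have heq := (hac.subsingleton_path u v).elim ⟨p.transfer H hpH, hp.transfer hpH⟩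
    ⟨p'.transfer H hpH', hp'.transfer hpH'⟩
  have hw : p.transfer H hpH = p'.transfer H hpH' := congrArg Subtype.val heq
  apply Walk.ext_support
  rw [← p.support_transfer hpH, hw, Walk.support_transfer]

/-- Below half the girth, a vertex has only one neighbor closer to a given vertex. -/
lemma eq_of_adj_of_dist_eq (hc : G.Connected) {u x y w : V} {i : ℕ}
    (hx : G.dist u x = i) (hy : G.dist u y = i) (hw : G.dist u w = i + 1)
    (hxw : G.Adj x w) (hyw : G.Adj y w) (hg : 2 * (i + 1) < G.girth) : x = y := by
  obtain ⟨p, hp⟩ := hc.exists_walk_length_eq_dist u x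
  obtain ⟨p', hp'⟩ := hc.exists_walk_length_eq_dist u y
  have h1 := (p.concat hxw).isPath_of_length_eq_dist (by rw [Walk.length_concat]; omega)
  have h2 := (p'.concat hyw).isPath_of_length_eq_dist (by rw [Walk.length_concat]; omega)
  have heq := path_eq_of_length_add_length_lt_girth h1 h2 (by
    rw [Walk.length_concat, Walk.length_concat]; omega)
  rw [← p.penultimate_concat hxw, heq, Walk.penultimate_concat]

/-- Below half the girth, spheres are independent sets. -/
lemma not_adj_of_dist_eq (hc : G.Connected) {u x y : V} {i : ℕ}
    (hx : G.dist u x = i) (hy : G.dist u y = i) (hg : 2 * i + 1 < G.girth) : ¬ G.Adj x y := by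
  classical
  intro hxy
  obtain ⟨p, hpp, hp⟩ := hc.exists_path_of_dist u x
  obtain ⟨p', hpp', hp'⟩ := hc.exists_path_of_dist u y
  have hy_notMem : y ∉ p.support := by
    intro hmem
    have h1 := dist_le (p.takeUntil y hmem)
    have h2 := congrArg Walk.length (p.take_spec hmem)
    rw [Walk.length_append] at h2
    have h3 : (p.dropUntil y hmem).length = 0 := by omega
    exact hxy.ne' (Walk.eq_of_length_eq_zero h3)
  have heq := path_eq_of_length_add_length_lt_girth (hpp.concat hy_notMem hxy) hpp' (by
    rw [Walk.length_concat]; omega)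
  have := congrArg Walk.length heq
  rw [Walk.length_concat] at this
  omega

variable [Fintype V]

open Classical in
/-- The vertices at distance `j` from `a` and `j + 1` from `b`. -/
noncomputable def branch (G : SimpleGraph V) (a b : V) (j : ℕ) : Finset V :=
  {w | G.dist a w = j ∧ G.dist b w = j + 1}

lemma mem_branch {a b w : V} {j : ℕ} :
    w ∈ branch G a b j ↔ G.dist a w = j ∧ G.dist b w = j + 1 := by
  simp [branch]

lemma mem_branch_succ_of_dist (hc : G.Connected) {a b x y : V} {j : ℕ} (hab : G.Adj a b)
    (hx : x ∈ branch G a b j) (hxy : G.Adj x y) (hy : G.dist b y = j + 2) :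
    y ∈ branch G a b (j + 1) := by
  rw [mem_branch] at hx ⊢
  have h1 := hc.dist_triangle (u := a) (v := x) (w := y)
  have h2 := hc.dist_triangle (u := b) (v := a) (w := y)
  rw [dist_eq_one_iff_adj.2 hxy] at h1
  rw [dist_eq_one_iff_adj.2 hab.symm] at h2
  omega

lemma pow_le_card_branch (hc : G.Connected) {δ : ℕ} (hδ : ∀ v, δ ≤ ndeg G v) {a b : V}
    (hab : G.Adj a b) (j : ℕ) (hg : 2 * j + 1 < G.girth) :
    (δ - 1) ^ j ≤ (branch G a b j).card := by
  classical
  induction j with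
  | zero =>
    rw [pow_zero, Nat.one_le_iff_ne_zero, Finset.card_ne_zero]
    exact ⟨a, by rw [mem_branch, dist_self, dist_eq_one_iff_adj.2 hab.symm]; simp⟩
  | succ j ih =>
    have key := Finset.card_mul_le_card_mul G.Adj (s := branch G a b j)
      (t := branch G a b (j + 1)) (m := δ - 1) (n := 1) ?_ ?_
    · rw [mul_one] at key
      rw [pow_succ]
      exact (Nat.mul_le_mul_right _ (ih (by omega))).trans key
    · intro x hx
      have hx' := mem_branch.1 hx
      have hsub : (((G.neighborSet x).toFinset.filter fun y => G.dist b y = j).card) ≤ 1 := by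
        rw [Finset.card_le_one]
        intro y hy z hz
        simp only [Finset.mem_filter, Set.mem_toFinset, mem_neighborSet] at hy hz
        exact eq_of_adj_of_dist_eq hc hy.2 hz.2 hx'.2 hy.1.symm hz.1.symm (by omega)
      have hcov : (G.neighborSet x).toFinset ⊆
          ((G.neighborSet x).toFinset.filter fun y => G.dist b y = j) ∪
            (branch G a b (j + 1)).bipartiteAbove G.Adj x := by
        intro y hy
        rw [Set.mem_toFinset, mem_neighborSet] at hy
        simp only [Finset.mem_union, Finset.mem_filter, Set.mem_toFinset, mem_neighborSet,
          Finset.mem_bipartiteAbove, hy, true_and, and_true]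
        by_cases hyj : G.dist b y = j
        · exact Or.inl hyj
        · refine Or.inr (mem_branch_succ_of_dist hc hab hx hy ?_)
          have hne : G.dist b y ≠ j + 1 := fun h =>
            not_adj_of_dist_eq hc hx'.2 h (by omega) hy
          have h1 := hc.dist_triangle (u := b) (v := x) (w := y)
          have h2 := hc.dist_triangle (u := b) (v := y) (w := x)
          rw [dist_eq_one_iff_adj.2 hy] at h1
          rw [dist_eq_one_iff_adj.2 hy.symm] at h2
          omega
      have h1 := Finset.card_le_card hcov
      have h2 := Finset.card_union_le ((G.neighborSet x).toFinset.filter fun y => G.dist b y = j)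
        ((branch G a b (j + 1)).bipartiteAbove G.Adj x)
      have h3 := hδ x
      rw [ndeg, Set.ncard_eq_toFinset_card'] at h3
      omega
    · intro y hy
      rw [Finset.card_le_one]
      intro x hx z hz
      rw [Finset.mem_bipartiteBelow, mem_branch] at hx hz
      exact eq_of_adj_of_dist_eq hc hx.1.1 hz.1.1 (mem_branch.1 hy).1 hx.2 hz.2 (by omega)

open Classical in
/-- The Moore bound for the disk around a vertex. -/
lemma moore_le_card_disk (hc : G.Connected) {δ k : ℕ} (hδ : ∀ v, δ ≤ ndeg G v)
    (hg : 2 * k < G.girth) (u : V) :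
    1 + δ * ∑ i ∈ Finset.range k, (δ - 1) ^ i ≤ (disk G k u).toFinset.card := by
  set N := (G.neighborSet u).toFinset with hN
  have hmemN : ∀ v, v ∈ N ↔ G.Adj u v := fun v => by simp [hN]
  set B : Finset V := N.biUnion fun v => (Finset.range k).biUnion fun i => branch G v u i with hB
  have hdist : ∀ v i w, w ∈ branch G v u i → G.dist u w = i + 1 := fun v i w hw =>
    (mem_branch.1 hw).2
  have hBcard : B.card = ∑ v ∈ N, ∑ i ∈ Finset.range k, (branch G v u i).card := by
    rw [hB, Finset.card_biUnion]
    · refine Finset.sum_congr rfl fun v _ => Finset.card_biUnion fun i _ j _ hij => ?_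
      refine Finset.disjoint_left.2 fun w hw hw' => ?_
      have := hdist _ _ _ hw
      have := hdist _ _ _ hw'
      omega
    · intro v hv v' hv' hne
      refine Finset.disjoint_left.2 fun w hw hw' => ?_
      simp only [Finset.mem_biUnion, Finset.mem_range] at hw hw'
      obtain ⟨i, hi, hw⟩ := hw
      obtain ⟨j, hj, hw'⟩ := hw'
      have h1 := hdist _ _ _ hw
      have h2 := hdist _ _ _ hw'
      obtain rfl : i = j := by omega
      rw [mem_branch, dist_comm] at hw hw'
      rw [dist_comm] at h1
      exact hne (eq_of_adj_of_dist_eq hc hw.1 hw'.1 h1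
        ((hmemN _).1 hv).symm ((hmemN _).1 hv').symm (by omega))
  have huB : u ∉ B := by
    intro hu
    simp only [hB, Finset.mem_biUnion] at hu
    obtain ⟨v, -, i, -, hw⟩ := hu
    have := hdist _ _ _ hw
    rw [dist_self] at this
    omega
  have hsub : insert u B ⊆ (disk G k u).toFinset := by
    intro w hw
    rw [Set.mem_toFinset]
    rw [Finset.mem_insert] at hw
    rcases hw with rfl | hw
    · simp [disk]
    · simp only [hB, Finset.mem_biUnion, Finset.mem_range] at hw
      obtain ⟨v, -, i, hi, hw⟩ := hw
      have := hdist _ _ _ hw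
      change G.dist u w ≤ k
      omega
  have hle := Finset.card_le_card hsub
  rw [Finset.card_insert_of_notMem huB, hBcard, add_comm] at hle
  refine le_trans (Nat.add_le_add_left ?_ 1) hle
  have hδu := hδ u
  rw [ndeg, Set.ncard_eq_toFinset_card', ← hN] at hδu
  calc δ * ∑ i ∈ Finset.range k, (δ - 1) ^ i
      ≤ N.card * ∑ i ∈ Finset.range k, (δ - 1) ^ i := Nat.mul_le_mul_right _ hδu
    _ = ∑ _v ∈ N, ∑ i ∈ Finset.range k, (δ - 1) ^ i := by rw [Finset.sum_const, smul_eq_mul]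
    _ ≤ _ := Finset.sum_le_sum fun v hv => Finset.sum_le_sum fun i hi =>
        pow_le_card_branch hc hδ ((hmemN v).1 hv).symm i (by
          rw [Finset.mem_range] at hi; omega)

open Classical in
/-- The Moore bound for the disk around an edge. -/
lemma moore_le_card_edisk (hc : G.Connected) {δ k : ℕ} (hδ : ∀ v, δ ≤ ndeg G v)
    (hg : 2 * k + 1 < G.girth) {u v : V} (huv : G.Adj u v) :
    2 + ∑ i ∈ Finset.Icc 1 k, 2 * (δ - 1) ^ i ≤ (edisk G k u v).toFinset.card := by
  set B : V → V → Finset V := fun a b =>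
    (Finset.range (k + 1)).biUnion fun i => branch G a b i with hB
  have hBcard : ∀ a b, G.Adj a b → ∑ i ∈ Finset.range (k + 1), (δ - 1) ^ i ≤ (B a b).card := by
    intro a b hab
    rw [hB, Finset.card_biUnion]
    · refine Finset.sum_le_sum fun i hi => pow_le_card_branch hc hδ hab i ?_
      rw [Finset.mem_range] at hi
      omega
    · intro i _ j _ hij
      refine Finset.disjoint_left.2 fun w hw hw' => ?_
      rw [mem_branch] at hw hw'
      omega
  have hdisj : Disjoint (B u v) (B v u) := by
    rw [Finset.disjoint_left]
    intro w hw hw'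
    simp only [hB, Finset.mem_biUnion, mem_branch] at hw hw'
    obtain ⟨i, -, h1, h2⟩ := hw
    obtain ⟨j, -, h3, h4⟩ := hw'
    omega
  have hsub : B u v ∪ B v u ⊆ (edisk G k u v).toFinset := by
    intro w hw
    rw [Set.mem_toFinset]
    simp only [hB, Finset.mem_union, Finset.mem_biUnion, Finset.mem_range, mem_branch] at hw
    rcases hw with ⟨i, hi, h, -⟩ | ⟨i, hi, h, -⟩
    · exact Or.inl (show G.dist u w ≤ k by omega)
    · exact Or.inr (show G.dist v w ≤ k by omega)
  have hle := Finset.card_le_card hsub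
  rw [Finset.card_union_of_disjoint hdisj] at hle
  have h1 := hBcard u v huv
  have h2 := hBcard v u huv.symm
  have h3 : ∑ i ∈ Finset.range (k + 1), (δ - 1) ^ i = 1 + ∑ i ∈ Finset.Icc 1 k, (δ - 1) ^ i := by
    rw [Finset.range_eq_Ico, Finset.sum_eq_sum_Ico_succ_bot (by omega)]
    rfl
  rw [← Finset.mul_sum]
  omega

end Moore

section Cyclic

variable {q : ℕ}

lemma eq_of_intCast_eq {x y : ℤ} (h : (x : ZMod q) = y) (hlt : |x - y| < q) : x = y := by
  rw [← sub_eq_zero, ← Int.cast_sub, ZMod.intCast_zmod_eq_zero_iff_dvd] at h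
  exact sub_eq_zero.1 (Int.eq_zero_of_abs_lt_dvd h hlt)

lemma card_image_add_range_le (m : ZMod q) (n : ℕ) :
    ((Finset.range n).image fun x : ℕ => m + (x : ZMod q)).card ≤ n :=
  Finset.card_image_le.trans (Finset.card_range n).le

variable [NeZero q]

lemma cycleDist_le_iff {i j : ZMod q} {c : ℕ} :
    cycleDist i j ≤ c ↔ ∃ z : ℤ, |z| ≤ c ∧ (z : ZMod q) = i - j := by
  constructor
  · intro h
    rcases min_le_iff.1 h with h | h
    · exact ⟨(i - j).val, by rw [Nat.abs_cast]; exact_mod_cast h, by simp⟩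
    · exact ⟨-(j - i).val, by rw [abs_neg, Nat.abs_cast]; exact_mod_cast h, by simp⟩
  · rintro ⟨z, hz, hij⟩
    obtain ⟨n, rfl | rfl⟩ := z.eq_nat_or_neg
    · refine (min_le_left _ _).trans ?_
      rw [← hij, Int.cast_natCast, ZMod.val_natCast]
      exact (Nat.mod_le _ _).trans (by simpa using hz)
    · refine (min_le_right _ _).trans ?_
      rw [← neg_sub, ← hij, Int.cast_neg, neg_neg, Int.cast_natCast, ZMod.val_natCast]
      exact (Nat.mod_le _ _).trans (by simpa using hz)

lemma two_mul_cycleDist_le (i j : ZMod q) : 2 * cycleDist i j ≤ q := by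
  unfold cycleDist
  by_cases h : i - j = 0
  · simp [h]
  · have : NeZero (i - j) := ⟨h⟩
    rw [← neg_sub i j, ZMod.val_neg_of_ne_zero]
    omega

/-- A set of small diameter on a long cycle is contained in a short interval starting in it. -/
lemma exists_interval_of_cycleDist_le {r : ℕ} (hq : 3 * r < q) {S : Finset (ZMod q)}
    (hne : S.Nonempty) (hS : ∀ s ∈ S, ∀ t ∈ S, cycleDist s t ≤ r) :
    ∃ m ∈ S, ∀ s ∈ S, ∃ x : ℕ, x ≤ r ∧ s = m + x := by
  obtain ⟨s₀, hs₀⟩ := hne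
  choose! z hz hz' using fun s (hs : s ∈ S) => cycleDist_le_iff.1 (hS s hs s₀ hs₀)
  obtain ⟨m, hm, hmin⟩ := S.exists_min_image z ⟨s₀, hs₀⟩
  refine ⟨m, hm, fun s hs => ?_⟩
  obtain ⟨w, hw, hw'⟩ := cycleDist_le_iff.1 (hS s hs m hm)
  have heq : z s - z m = w := by
    apply eq_of_intCast_eq (q := q)
    · push_cast
      rw [hz' s hs, hz' m hm, hw']
      ring
    · have h1 := abs_le.1 (hz s hs)
      have h2 := abs_le.1 (hz m hm)
      have h3 := abs_le.1 hw
      rw [abs_lt]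
      constructor <;> omega
  have h0 := hmin s hs
  have h3 := abs_le.1 hw
  refine ⟨w.toNat, by omega, ?_⟩
  have h4 : ((w.toNat : ℤ) : ZMod q) = (w : ZMod q) := by rw [Int.toNat_of_nonneg (by omega)]
  rw [Int.cast_natCast] at h4
  rw [h4, hw']
  ring

lemma card_le_of_cycleDist_le {r : ℕ} (hq : 3 * r < q) {S : Finset (ZMod q)}
    (hS : ∀ s ∈ S, ∀ t ∈ S, cycleDist s t ≤ r) :
    S.card ≤ r + 1 ∧ (S.card = r + 1 → ∃ m ∈ S, m + (r : ZMod q) ∈ S) := by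
  rcases S.eq_empty_or_nonempty with rfl | hne
  · simp
  obtain ⟨m, hm, hint⟩ := exists_interval_of_cycleDist_le hq hne hS
  have hsub : S ⊆ (Finset.range (r + 1)).image fun x : ℕ => m + (x : ZMod q) := by
    intro s hs
    obtain ⟨x, hx, rfl⟩ := hint s hs
    exact Finset.mem_image_of_mem _ (Finset.mem_range.2 (by omega))
  refine ⟨(Finset.card_le_card hsub).trans (card_image_add_range_le m _), fun hcard => ⟨m, hm, ?_⟩⟩
  rw [Finset.eq_of_subset_of_card_le hsub (hcard ▸ card_image_add_range_le m _)]
  exact Finset.mem_image_of_mem _ (Finset.mem_range.2 (by omega))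

lemma card_edges_le_of_cycleDist_le {r : ℕ} (hq : 3 * r + 1 < q) {S E : Finset (ZMod q)}
    (hS : ∀ s ∈ S, ∀ t ∈ S, cycleDist s t ≤ r) (hE : ∀ s, s ∈ E ↔ s ∈ S ∨ s + 1 ∈ S) :
    E.card ≤ r + 2 ∧ (E.card = r + 2 → ∃ m ∈ S, m + (r : ZMod q) ∈ S) := by
  rcases S.eq_empty_or_nonempty with rfl | hne
  · obtain rfl : E = ∅ := Finset.eq_empty_of_forall_notMem fun s hs => by simpa using (hE s).1 hs
    simp
  obtain ⟨m, hm, hint⟩ := exists_interval_of_cycleDist_le (by omega) hne hS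
  have hsub : E ⊆ (Finset.range (r + 2)).image fun x : ℕ => m - 1 + (x : ZMod q) := by
    intro s hs
    rw [Finset.mem_image]
    rcases (hE s).1 hs with hs | hs
    · obtain ⟨x, hx, h⟩ := hint s hs
      exact ⟨x + 1, Finset.mem_range.2 (by omega), by rw [h]; push_cast; ring⟩
    · obtain ⟨x, hx, h⟩ := hint _ hs
      exact ⟨x, Finset.mem_range.2 (by omega), by rw [eq_sub_of_add_eq h]; ring⟩
  refine ⟨(Finset.card_le_card hsub).trans (card_image_add_range_le _ _), fun hcard => ⟨m, hm, ?_⟩⟩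
  have hmem : m + (r : ZMod q) ∈ E := by
    rw [Finset.eq_of_subset_of_card_le hsub (hcard ▸ card_image_add_range_le _ _)]
    exact Finset.mem_image.2 ⟨r + 1, Finset.mem_range.2 (by omega), by push_cast; ring⟩
  refine ((hE _).1 hmem).resolve_right fun h => ?_
  obtain ⟨x, hx, h⟩ := hint _ h
  have : ((r + 1 : ℤ) : ZMod q) = ((x : ℤ) : ZMod q) := by
    push_cast
    linear_combination h
  have := eq_of_intCast_eq this (by rw [abs_lt]; constructor <;> omega)
  omega

/-- If three pairs of shifted indices are close, then so are the indices themselves. -/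
lemma cycleDist_le_of_shifts {k e : ℕ} (he : e ≤ 1) (hq : 6 * k + 3 < q) {i j : ZMod q}
    (h₁ : cycleDist (i - (k : ZMod q)) (j + (k : ZMod q)) ≤ 2 * k + e)
    (h₂ : cycleDist (i + (k : ZMod q)) (j - (k : ZMod q)) ≤ 2 * k + e)
    (h₃ : cycleDist i j ≤ 2 * k + e) : cycleDist i j ≤ e := by
  rw [cycleDist_le_iff] at *
  obtain ⟨x, hx, hx'⟩ := h₁
  obtain ⟨y, hy, hy'⟩ := h₂
  obtain ⟨z, hz, hz'⟩ := h₃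
  rw [abs_le] at hx hy hz
  push_cast at hx hy hz
  have h1 : x + 2 * k = z := eq_of_intCast_eq (q := q)
    (by push_cast; linear_combination hx' - hz') (by rw [abs_lt]; constructor <;> omega)
  have h2 : y - 2 * k = z := eq_of_intCast_eq (q := q)
    (by push_cast; linear_combination hy' - hz') (by rw [abs_lt]; constructor <;> omega)
  exact ⟨z, by rw [abs_le]; constructor <;> omega, hz'⟩

lemma cycleDist_le_of_two_shifts {k : ℕ} (hq : 6 * k < q) {i m : ZMod q}
    (h₁ : cycleDist (m - (k : ZMod q)) i ≤ 2 * k) (h₂ : cycleDist (m + (k : ZMod q)) i ≤ 2 * k) :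
    cycleDist m i ≤ k := by
  rw [cycleDist_le_iff] at *
  obtain ⟨x, hx, hx'⟩ := h₁
  obtain ⟨y, hy, hy'⟩ := h₂
  rw [abs_le] at hx hy
  push_cast at hx hy
  have h1 : x + 2 * k = y := eq_of_intCast_eq (q := q)
    (by push_cast; linear_combination hx' - hy') (by rw [abs_lt]; constructor <;> omega)
  refine ⟨x + k, by rw [abs_le]; constructor <;> omega, ?_⟩
  push_cast
  linear_combination hx'

/-- A `1`-Lipschitz self-map of a cycle whose image is `k`-dense, with `q > 4 * k + 2`,
is surjective. -/
lemma surjective_of_lipschitz_of_dense {k : ℕ} (hq : 4 * k + 2 < q) {ψ : ZMod q → ZMod q}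
    (hlip : ∀ t, cycleDist (ψ (t + 1)) (ψ t) ≤ 1) (hdense : ∀ i, ∃ t, cycleDist (ψ t) i ≤ k) :
    Function.Surjective ψ := by
  intro m
  by_contra! hm
  set a : ZMod q → ℤ := fun t => (ψ t - m).val with ha
  have hcast : ∀ t, (a t : ZMod q) = ψ t - m := fun t => by simp [ha]
  have hpos : ∀ t, 0 < a t := fun t => by
    have : (ψ t - m).val ≠ 0 := by rw [Ne, ZMod.val_eq_zero, sub_eq_zero]; exact hm t
    simp only [ha]
    omega
  have hlt : ∀ t, a t < q := fun t => by
    simp only [ha]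
    exact_mod_cast ZMod.val_lt _
  have hstep : ∀ t, |a (t + 1) - a t| ≤ 1 := by
    intro t
    obtain ⟨z, hz, hz'⟩ := cycleDist_le_iff.1 (hlip t)
    rw [abs_le] at hz
    push_cast at hz
    have h1 := hpos t
    have h2 := hpos (t + 1)
    have h3 := hlt t
    have h4 := hlt (t + 1)
    by_cases h : a t + z = 0 ∨ a t + z = q
    · refine absurd ?_ (hm (t + 1))
      have : ((a t + z : ℤ) : ZMod q) = 0 := by rcases h with h | h <;> simp [h]
      push_cast at this
      rw [hcast, hz'] at this
      linear_combination this
    have : a (t + 1) = a t + z := eq_of_intCast_eq (q := q)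
      (by push_cast; rw [hcast, hcast, hz']; ring) (by rw [abs_lt]; constructor <;> omega)
    rw [this, abs_le]
    constructor <;> omega
  have hnat : ∀ (n : ℕ) t, |a (t + n) - a t| ≤ n := by
    intro n t
    induction n with
    | zero => simp
    | succ n ih =>
      have h := hstep (t + n)
      rw [add_assoc] at h
      rw [abs_le] at *
      push_cast
      constructor <;> omega
  have hdist : ∀ s t, |a s - a t| ≤ cycleDist s t := by
    intro s t
    have h1 := hnat (s - t).val t
    have h2 := hnat (t - s).val s
    rw [ZMod.natCast_zmod_val, add_sub_cancel] at h1 h2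
    rw [abs_sub_comm] at h2
    simpa [cycleDist] using And.intro h1 h2
  obtain ⟨s, hs⟩ := Finite.exists_min a
  obtain ⟨t, ht⟩ := hdense (ψ s - (k + 1))
  obtain ⟨z, hz, hz'⟩ := cycleDist_le_iff.1 ht
  rw [abs_le] at hz
  have hst := hdist t s
  have hhalf := two_mul_cycleDist_le t s
  have hmin := hs t
  rw [abs_le] at hst
  have : a t - a s = z - (k + 1) := eq_of_intCast_eq (q := q)
    (by push_cast; rw [hcast, hcast, hz']; ring) (by rw [abs_lt]; constructor <;> omega)
  omega

end Cyclic

/-- The equality case of double counting. -/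
lemma card_eq_of_card_mul_eq_card_mul {ι α : Type*} [Fintype ι] [Fintype α] (r : ι → α → Prop)
    [∀ i v, Decidable (r i v)] {M g : ℕ}
    (hlow : ∀ i, M ≤ (Finset.univ.bipartiteAbove r i).card)
    (hup : ∀ v, (Finset.univ.bipartiteBelow r v).card ≤ g)
    (hcard : g * Fintype.card α = Fintype.card ι * M) (v : α) :
    (Finset.univ.bipartiteBelow r v).card = g := by
  have hsum : ∑ v : α, (Finset.univ.bipartiteBelow r v).card = ∑ _v : α, g := by
    refine le_antisymm (Finset.sum_le_sum fun v _ => hup v) ?_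
    rw [← Finset.sum_card_bipartiteAbove_eq_sum_card_bipartiteBelow, Finset.sum_const, smul_eq_mul,
      Finset.card_univ, mul_comm, hcard, ← Finset.card_univ, ← smul_eq_mul, ← Finset.sum_const]
    exact Finset.sum_le_sum fun i _ => hlow i
  exact (Finset.sum_eq_sum_iff_of_le fun v _ => hup v).1 hsum v (Finset.mem_univ v)

section Partition

variable {V : Type*} {G : SimpleGraph V} {δ g q k : ℕ} {f : ZMod q → V}

lemma mem_Lpart {i : ZMod q} {v : V} :
    v ∈ Lpart G k f i ↔ G.dist (f (i - (k : ZMod q))) v ≤ k ∧ G.dist (f (i + (k : ZMod q))) v ≤ k :=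
  Iff.rfl

lemma cycleDist_le_of_dist (hc : G.Connected) (hf : IsIsoCycle G q f) {i j : ZMod q} {v w : V}
    {a b c : ℕ} (hi : G.dist (f i) v ≤ a) (hj : G.dist (f j) w ≤ b) (hvw : G.dist v w ≤ c) :
    cycleDist i j ≤ a + b + c := by
  have h1 := hc.dist_triangle (u := f i) (v := v) (w := f j)
  have h2 := hc.dist_triangle (u := v) (v := w) (w := f j)
  rw [G.dist_comm (u := w)] at h2
  rw [← hf.2]
  omega

lemma adj_succ [NeZero q] (hf : IsIsoCycle G q f) (i : ZMod q) : G.Adj (f i) (f (i + 1)) := by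
  have : Fact (1 < q) := ⟨by have := hf.1; omega⟩
  have hle : cycleDist i (i + 1) ≤ 1 := cycleDist_le_iff.2 ⟨-1, by simp, by simp⟩
  rw [← dist_eq_one_iff_adj]
  refine le_antisymm (hf.2 _ _ ▸ hle) (Nat.one_le_iff_ne_zero.2 fun h => ?_)
  rw [hf.2, cycleDist, Nat.min_eq_zero_iff, ZMod.val_eq_zero, ZMod.val_eq_zero] at h
  simp at h

/-- The sets `L i` cover the equatorial graph. -/
lemma exists_mem_Lpart (hG : IsEquatorial G δ g q) (hk : k = (g + 1) / 2 - 1)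
    (hf : IsIsoCycle G q f) (v : V) : ∃ i, v ∈ Lpart G k f i := by
  classical
  obtain ⟨hfin, hc, hgirth, ⟨hδ, -⟩, -, hq, hcard⟩ := hG
  have := Fintype.ofFinite V
  have : NeZero q := ⟨by omega⟩
  rw [← hk] at hq
  have hg3 : 3 ≤ g := by
    rw [← hgirth]
    refine three_le_girth fun hac => ?_
    rw [girth_eq_zero.2 hac] at hgirth
    subst hgirth
    simp [mooreBound] at hcard
    omega
  suffices h : ∃ m, G.dist (f m) v ≤ k ∧ G.dist (f (m + (2 * k : ℕ))) v ≤ k by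
    obtain ⟨m, h1, h2⟩ := h
    refine ⟨m + k, mem_Lpart.2 ⟨by rwa [add_sub_cancel_right], ?_⟩⟩
    convert h2 using 3
    push_cast
    ring
  set S : V → Finset (ZMod q) := fun w => {i | G.dist (f i) w ≤ k} with hS
  have memS : ∀ w i, i ∈ S w ↔ G.dist (f i) w ≤ k := fun w i => by simp [hS]
  have hclose : ∀ w, ∀ s ∈ S w, ∀ t ∈ S w, cycleDist s t ≤ 2 * k := by
    intro w s hs t ht
    rw [memS] at hs ht
    have := cycleDist_le_of_dist hc hf hs ht (c := 0) (by simp)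
    omega
  simp only [← memS]
  rw [Nat.card_eq_fintype_card, ← ZMod.card q] at hcard
  unfold mooreBound at hcard
  rw [← hk] at hcard
  by_cases hodd : Odd g
  · rw [if_pos hodd] at hcard
    obtain ⟨l, hl⟩ := hodd
    have hbound := fun w => card_le_of_cycleDist_le (by omega) (hclose w)
    have heq := card_eq_of_card_mul_eq_card_mul (fun i w => G.dist (f i) w ≤ k)
      (fun i => ?_) (fun w => (hbound w).1.trans (by omega)) hcard v
    · exact (hbound v).2 (heq.trans (by omega))
    · refine (moore_le_card_disk hc hδ (by omega) (f i)).trans (Finset.card_le_card fun w hw => ?_)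
      rw [Set.mem_toFinset] at hw
      exact (Finset.mem_bipartiteAbove _).2 ⟨Finset.mem_univ w, hw⟩
  · rw [if_neg hodd] at hcard
    obtain ⟨l, hl⟩ := Nat.not_odd_iff_even.1 hodd
    set r : ZMod q → V → Prop := fun i w => G.dist (f i) w ≤ k ∨ G.dist (f (i + 1)) w ≤ k
    have hbound := fun w => card_edges_le_of_cycleDist_le (E := Finset.univ.bipartiteBelow r w)
      (by omega) (hclose w) (fun s => by simp [r, memS])
    have heq := card_eq_of_card_mul_eq_card_mul r
      (fun i => ?_) (fun w => (hbound w).1.trans (by omega)) hcard v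
    · exact (hbound v).2 (heq.trans (by omega))
    · refine (moore_le_card_edisk hc hδ (by omega) (adj_succ hf i)).trans
        (Finset.card_le_card fun w hw => ?_)
      rw [Set.mem_toFinset] at hw
      exact (Finset.mem_bipartiteAbove _).2 ⟨Finset.mem_univ w, hw⟩

lemma cycleDist_le_of_mem_Lpart [NeZero q] (hc : G.Connected) (hf : IsIsoCycle G q f)
    (hq : 6 * k + 3 < q) {i j : ZMod q} {v w : V} {e : ℕ} (he : e ≤ 1)
    (hv : v ∈ Lpart G k f i) (hw : w ∈ Lpart G k f j) (hvw : G.dist v w ≤ e) :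
    cycleDist i j ≤ e := by
  rw [mem_Lpart] at hv hw
  refine cycleDist_le_of_shifts he hq ?_ ?_ ?_
  · have := cycleDist_le_of_dist hc hf hv.1 hw.2 hvw
    omega
  · have := cycleDist_le_of_dist hc hf hv.2 hw.1 hvw
    omega
  · have := cycleDist_le_of_dist hc hf hv.1 hw.1 hvw
    rw [cycleDist, sub_sub_sub_cancel_right, sub_sub_sub_cancel_right] at this
    rw [cycleDist]
    omega

lemma eq_of_mem_Lpart [NeZero q] (hc : G.Connected) (hf : IsIsoCycle G q f)
    (hq : 6 * k + 3 < q) {i j : ZMod q} {v : V}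
    (hi : v ∈ Lpart G k f i) (hj : v ∈ Lpart G k f j) : i = j := by
  have h := cycleDist_le_of_mem_Lpart hc hf hq zero_le_one hi hj (by simp)
  obtain ⟨z, hz, hij⟩ := cycleDist_le_iff.1 h
  obtain rfl : z = 0 := by simpa using hz
  exact sub_eq_zero.1 (by simpa using hij.symm)

end Partition

end EquatorialGraph

open EquatorialGraph in
/-- Lemma 5.8: every isometric `q`-cycle `D` meets each part `L i` of the partition
induced by `C` in exactly one vertex. -/
theorem stmt_13 {V : Type*} (G : SimpleGraph V) (δ g q k : ℕ)
    (hG : IsEquatorial G δ g q) (hk : k = (g + 1) / 2 - 1)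
    (f : ZMod q → V) (hf : IsIsoCycle G q f)
    (h : ZMod q → V) (hh : IsIsoCycle G q h) :
    ∀ i : ZMod q, (Set.range h ∩ Lpart G k f i).ncard = 1 := by
  obtain ⟨-, hc, -, -, -, hq, -⟩ := id hG
  rw [← hk] at hq
  have : NeZero q := ⟨by omega⟩
  choose φ hφ using exists_mem_Lpart hG hk hf
  have hsurj : Function.Surjective (fun t => φ (h t)) := by
    refine surjective_of_lipschitz_of_dense (k := k) (by omega) (fun t => ?_) (fun i => ?_)
    · refine cycleDist_le_of_mem_Lpart hc hf hq le_rfl (hφ _) (hφ _) ?_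
      rw [dist_eq_one_iff_adj.2 (adj_succ hh t).symm]
    · obtain ⟨j, hj⟩ := exists_mem_Lpart hG hk hh (f i)
      have hL := mem_Lpart.1 (hφ (h (j + (k : ZMod q))))
      have hfi : G.dist (f i) (h (j + (k : ZMod q))) ≤ k := G.dist_comm ▸ (mem_Lpart.1 hj).2
      refine ⟨j + k, cycleDist_le_of_two_shifts (by omega) ?_ ?_⟩
      · have := cycleDist_le_of_dist hc hf hL.1 hfi (c := 0) (by simp)
        omega
      · have := cycleDist_le_of_dist hc hf hL.2 hfi (c := 0) (by simp)
        omega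
  have hinj := Finite.injective_iff_surjective.2 hsurj
  intro i
  obtain ⟨t, rfl⟩ := hsurj i
  rw [Set.ncard_eq_one]
  refine ⟨h t, Set.eq_singleton_iff_unique_mem.2 ⟨⟨⟨t, rfl⟩, hφ _⟩, ?_⟩⟩
  rintro _ ⟨⟨s, rfl⟩, hs⟩
  exact congrArg h (hinj (eq_of_mem_Lpart hc hf hq (hφ (h s)) hs))
end

section
/- Let G be an equatorial graph with equator q. Then every isometric cycle of length q in G induces the same partition of the vertex set of G: if C and D are two isometric cycles of length q, then the family of parts {L_i} induced by C equals, as a set partition of V(G) (up to relabeling indices), the family of parts {M_i} induced by D. -/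
open SimpleGraph

section Moore

variable {V : Type*} {G : SimpleGraph V}

/-- Two neighbours of `x`, neither farther from `v` than `x`, coincide if the closed walk through
`v` that they produce is shorter than the girth. -/
lemma eq_of_adj_of_dist_le (hc : G.Connected) {v x y z : V} (hxy : G.Adj y x) (hxz : G.Adj z x)
    (hy : G.dist v y ≤ G.dist v x) (hz : G.dist v z ≤ G.dist v x)
    (hlt : G.dist v y + G.dist v z + 2 < G.girth) : y = z := by
  classical
  have key : ∀ w, G.Adj w x → G.dist v w ≤ G.dist v x → ∀ p : G.Walk v w, p.IsPath →
      p.length = G.dist v w → x ∉ p.support := by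
    intro w hw hle p _ hp hx
    have h1 := Walk.length_takeUntil_lt_length hx hw.ne'
    have h2 := dist_le (p.takeUntil x hx)
    omega
  obtain ⟨p, hp, hpl⟩ := hc.exists_path_of_dist v y
  obtain ⟨r, hr, hrl⟩ := hc.exists_path_of_dist v z
  by_contra hne
  have hne' : p.concat hxy ≠ r.concat hxz := fun he => hne (Walk.concat_inj he).1
  obtain ⟨w, -, -, c, hcyc, hlen⟩ :=
    (hp.concat (key y hxy hy p hp hpl) hxy).exists_isCycle_length_le_add_of_ne
      (hr.concat (key z hxz hz r hr hrl) hxz) hne'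
  have := girth_le_length hcyc
  simp only [Walk.length_concat] at hlen
  omega

/-- A neighbour of `x` that is not farther from `v` than `x` is unique below half the girth. -/
lemma eq_of_adj_of_dist_le_of_girth (hc : G.Connected) {v x y z : V} (hxy : G.Adj x y)
    (hxz : G.Adj x z) (hy : G.dist v y ≤ G.dist v x) (hz : G.dist v z ≤ G.dist v x)
    (hlt : 2 * G.dist v x + 1 < G.girth) : y = z := by
  have hvx : x ≠ v := by
    rintro rfl
    simp only [dist_self, nonpos_iff_eq_zero, hc.dist_eq_zero_iff] at hy
    exact hxy.ne hy
  obtain ⟨w, hw, hwd⟩ : ∃ w, G.Adj w x ∧ G.dist v w + 1 = G.dist v x := by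
    obtain ⟨p, hp⟩ := hc.exists_walk_length_eq_dist x v
    cases p with
    | nil => exact absurd rfl hvx
    | @cons _ w _ h p =>
      refine ⟨w, h.symm, ?_⟩
      have h1 := dist_le p
      have h2 := hc.dist_triangle (u := v) (v := w) (w := x)
      rw [dist_eq_one_iff_adj.2 h.symm] at h2
      rw [Walk.length_cons] at hp
      rw [dist_comm (u := x)] at hp
      rw [dist_comm (u := w)] at h1
      omega
  have := eq_of_adj_of_dist_le hc hxy.symm hw hy (by omega) (by omega)
  have := eq_of_adj_of_dist_le hc hxz.symm hw hz (by omega) (by omega)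
  simp_all

lemma dist_le_succ_of_adj (hc : G.Connected) (v : V) {x y : V} (h : G.Adj x y) :
    G.dist v y ≤ G.dist v x + 1 := by
  have := hc.dist_triangle (u := v) (v := x) (w := y)
  rwa [dist_eq_one_iff_adj.2 h] at this

lemma card_mul_le_of_expansion [Finite V] {A B : Finset V} {d : ℕ} (hd : ∀ x, d ≤ ndeg G x)
    (hA : ∀ x ∈ A, ∀ y z, G.Adj x y → G.Adj x z → y ∉ B → z ∉ B → y = z)
    (hB : ∀ y ∈ B, ∀ x ∈ A, ∀ z ∈ A, G.Adj x y → G.Adj z y → x = z) :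
    A.card * (d - 1) ≤ B.card := by
  classical
  have := Fintype.ofFinite V
  have h := Finset.card_mul_le_card_mul G.Adj (s := A) (t := B) (m := d - 1) (n := 1) ?_ ?_
  · simpa using h
  · intro x hx
    have h1 : d ≤ (Finset.univ.filter (G.Adj x)).card := by
      refine (hd x).trans (le_of_eq ?_)
      rw [ndeg, ← Set.ncard_coe_finset]
      congr 1
      ext; simp
    have h2 : (Finset.univ.filter fun y => G.Adj x y ∧ y ∉ B).card ≤ 1 := by
      rw [Finset.card_le_one]
      simp only [Finset.mem_filter, Finset.mem_univ, true_and]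
      exact fun y hy z hz => hA x hx y z hy.1 hz.1 hy.2 hz.2
    have h3 : Finset.univ.filter (G.Adj x) ⊆
        B.bipartiteAbove G.Adj x ∪ Finset.univ.filter fun y => G.Adj x y ∧ y ∉ B := by
      intro y
      simp only [Finset.mem_filter, Finset.mem_univ, true_and, Finset.mem_union,
        Finset.mem_bipartiteAbove]
      tauto
    have h4 := (Finset.card_le_card h3).trans (Finset.card_union_le _ _)
    omega
  · intro y hy
    rw [Finset.card_le_one]
    simp only [Finset.mem_bipartiteBelow]
    exact fun x hx z hz => hB y hy x hx.1 z hz.1 hx.2 hz.2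

lemma le_card_sphere [Fintype V] (hc : G.Connected) {d : ℕ} (hd : ∀ x, d ≤ ndeg G x) (v : V)
    (n : ℕ) (hn : 2 * n + 2 < G.girth) :
    d * (d - 1) ^ n ≤ (Finset.univ.filter fun x => G.dist v x = n + 1).card := by
  classical
  induction n with
  | zero =>
    simp only [pow_zero, mul_one, zero_add]
    refine (hd v).trans (le_of_eq ?_)
    rw [ndeg, ← Set.ncard_coe_finset]
    congr 1
    ext; simp [dist_eq_one_iff_adj]
  | succ n ih =>
    have ih := ih (by omega)
    refine le_trans ?_ (card_mul_le_of_expansion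
      (A := Finset.univ.filter fun x => G.dist v x = n + 1) hd ?_ ?_)
    · rw [pow_succ, ← mul_assoc]
      exact Nat.mul_le_mul_right _ ih
    · simp only [Finset.mem_filter, Finset.mem_univ, true_and]
      intro x hx y z hy hz hyB hzB
      have h1 := dist_le_succ_of_adj hc v hy
      have h2 := dist_le_succ_of_adj hc v hz
      exact eq_of_adj_of_dist_le_of_girth (v := v) hc hy hz (by omega) (by omega) (by omega)
    · simp only [Finset.mem_filter, Finset.mem_univ, true_and]
      intro y hy x hx z hz hxy hzy
      exact eq_of_adj_of_dist_le (v := v) hc hxy hzy (by omega) (by omega) (by omega)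

lemma le_card_halfSphere [Fintype V] (hc : G.Connected) {d : ℕ} (hd : ∀ x, d ≤ ndeg G x)
    {u v : V} (huv : G.Adj u v) (n : ℕ) (hn : 2 * n + 1 < G.girth) :
    (d - 1) ^ n ≤ (Finset.univ.filter fun x => G.dist u x = n ∧ G.dist v x = n + 1).card := by
  classical
  induction n with
  | zero =>
    rw [pow_zero, Nat.one_le_iff_ne_zero, ← Nat.pos_iff_ne_zero, Finset.card_pos]
    exact ⟨u, by simp [dist_eq_one_iff_adj, huv.symm]⟩
  | succ n ih =>
    have ih := ih (by omega)
    refine le_trans ?_ (card_mul_le_of_expansion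
      (A := Finset.univ.filter fun x => G.dist u x = n ∧ G.dist v x = n + 1) hd ?_ ?_)
    · rw [pow_succ]
      exact Nat.mul_le_mul_right _ ih
    · simp only [Finset.mem_filter, Finset.mem_univ, true_and]
      intro x hx y z hy hz hyB hzB
      have h1 := dist_le_succ_of_adj hc u hy
      have h2 := dist_le_succ_of_adj hc u hz
      have h3 := dist_le_succ_of_adj hc y huv
      have h4 := dist_le_succ_of_adj hc z huv
      have h5 := dist_le_succ_of_adj hc v hy
      have h6 := dist_le_succ_of_adj hc v hz
      rw [dist_comm (u := y), dist_comm (u := y)] at h3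
      rw [dist_comm (u := z), dist_comm (u := z)] at h4
      exact eq_of_adj_of_dist_le_of_girth (v := v) hc hy hz (by omega) (by omega) (by omega)
    · simp only [Finset.mem_filter, Finset.mem_univ, true_and]
      intro y hy x hx z hz hxy hzy
      exact eq_of_adj_of_dist_le (v := u) hc hxy hzy (by omega) (by omega) (by omega)

lemma mooreBound_le_card_disk [Fintype V] (hc : G.Connected) {d k : ℕ} (hd : ∀ x, d ≤ ndeg G x)
    (hg : G.girth = 2 * k + 1) (u : V) :
    mooreBound d (2 * k + 1) ≤ (Finset.univ.filter fun x => G.dist u x ≤ k).card := by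
  classical
  have hk : (2 * k + 1 + 1) / 2 - 1 = k := by omega
  have hsum : (Finset.univ.filter fun x => G.dist u x ≤ k).card =
      ∑ n ∈ Finset.range (k + 1), (Finset.univ.filter fun x => G.dist u x = n).card := by
    rw [Finset.card_eq_sum_card_fiberwise (f := fun x => G.dist u x) (t := Finset.range (k + 1))]
    · refine Finset.sum_congr rfl fun n hn => ?_
      rw [Finset.mem_range] at hn
      congr 1
      ext x
      simp only [Finset.mem_filter, Finset.mem_univ, true_and]
      omega
    · intro x hx
      simpa [Nat.lt_succ_iff] using hx
  rw [mooreBound, if_pos ⟨k, rfl⟩, hk, hsum, Finset.sum_range_succ', add_comm, Finset.mul_sum]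
  refine add_le_add (Finset.sum_le_sum fun n hn => ?_) ?_
  · rw [Finset.mem_range] at hn
    exact le_card_sphere hc hd u n (by omega)
  · rw [Nat.one_le_iff_ne_zero, ← Nat.pos_iff_ne_zero, Finset.card_pos]
    exact ⟨u, by simp⟩

lemma mooreBound_le_card_edisk [Fintype V] (hc : G.Connected) {d k : ℕ}
    (hd : ∀ x, d ≤ ndeg G x) (hg : G.girth = 2 * k + 2) {u v : V} (huv : G.Adj u v) :
    mooreBound d (2 * k + 2) ≤
      (Finset.univ.filter fun x => G.dist u x ≤ k ∨ G.dist v x ≤ k).card := by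
  classical
  have hk : (2 * k + 2 + 1) / 2 - 1 = k := by omega
  have hbound : mooreBound d (2 * k + 2) =
      ∑ n ∈ Finset.range (k + 1), ((d - 1) ^ n + (d - 1) ^ n) := by
    rw [mooreBound, if_neg (by simp [Nat.not_odd_iff_even, Nat.even_add]), hk,
      Finset.sum_range_succ', Finset.range_eq_Ico,
      Finset.sum_Ico_add' (fun n => (d - 1) ^ n + (d - 1) ^ n) 0 k 1, add_comm]
    simp only [two_mul]
    congr 1
  have hterm : ∀ n ∈ Finset.range (k + 1), (d - 1) ^ n + (d - 1) ^ n ≤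
      ((Finset.univ.filter fun x => G.dist u x = n ∧ G.dist v x = n + 1) ∪
        (Finset.univ.filter fun x => G.dist v x = n ∧ G.dist u x = n + 1)).card := by
    intro n hn
    rw [Finset.mem_range] at hn
    rw [Finset.card_union_of_disjoint]
    · exact add_le_add (le_card_halfSphere hc hd huv n (by omega))
        (le_card_halfSphere hc hd huv.symm n (by omega))
    · rw [Finset.disjoint_filter]
      omega
  rw [hbound]
  refine (Finset.sum_le_sum hterm).trans ?_
  rw [← Finset.card_biUnion]
  · refine Finset.card_le_card fun x => ?_
    simp only [Finset.mem_biUnion, Finset.mem_range, Finset.mem_union, Finset.mem_filter,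
      Finset.mem_univ, true_and]
    rintro ⟨n, hn, h | h⟩ <;> omega
  · intro n _ m _ hnm
    simp only [Function.onFun]
    rw [Finset.disjoint_left]
    intro x
    simp only [Finset.mem_union, Finset.mem_filter, Finset.mem_univ, true_and]
    omega

end Moore

section CycleDist

variable {q : ℕ} [NeZero q]

lemma cycleDist_add_natCast (i : ZMod q) {n : ℕ} (hn : n ≤ q) :
    cycleDist i (i + n) = min n (q - n) := by
  rw [cycleDist, sub_add_cancel_left, add_sub_cancel_left, ZMod.neg_val]
  rcases hn.eq_or_lt with rfl | hlt
  · simp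
  · rw [ZMod.val_natCast_of_lt hlt]
    split_ifs with h0
    · have : n = 0 := by rw [← ZMod.val_natCast_of_lt hlt, h0, ZMod.val_zero]
      omega
    · exact min_comm _ _

lemma exists_natCast_eq_cycleDist (i j : ZMod q) :
    ∃ n : ℕ, 2 * n ≤ q ∧ cycleDist i j = n ∧ (j = i + n ∨ i = j + n) := by
  have hlt : (j - i).val < q := ZMod.val_lt _
  have hj : j = i + ((j - i).val : ZMod q) := by rw [ZMod.natCast_zmod_val]; ring
  have hi : i = j + ((q - (j - i).val : ℕ) : ZMod q) := by
    rw [Nat.cast_sub hlt.le, ZMod.natCast_zmod_val, ZMod.natCast_self]; ring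
  have hd := cycleDist_add_natCast i hlt.le
  rw [← hj] at hd
  rcases le_total (2 * (j - i).val) q with h | h
  · exact ⟨_, h, by omega, .inl hj⟩
  · exact ⟨_, by omega, by omega, .inr hi⟩

lemma cycleDist_eq_zero {i j : ZMod q} : cycleDist i j = 0 ↔ i = j := by
  constructor
  · intro h
    obtain ⟨n, -, hn, h'⟩ := exists_natCast_eq_cycleDist i j
    obtain rfl : n = 0 := by omega
    simpa [eq_comm] using h'
  · rintro rfl
    simp [cycleDist]

/-- A set of indices of diameter at most `2k` in a long cycle lies on an arc of length `2k`. -/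
lemma exists_arc {k : ℕ} (hq : 6 * k < q) {S : Set (ZMod q)} (hS : S.Nonempty)
    (hd : ∀ i ∈ S, ∀ j ∈ S, cycleDist i j ≤ 2 * k) :
    ∃ a ∈ S, ∀ i ∈ S, (i - a).val ≤ 2 * k := by
  classical
  obtain ⟨s, hs⟩ := hS
  have hoff : ∀ i ∈ S, (i - s + (2 * k : ℕ)).val ≤ 4 * k := by
    intro i hi
    obtain ⟨n, hn, hn', rfl | rfl⟩ := exists_natCast_eq_cycleDist i s
    · have hle := hd _ hi _ hs
      rw [sub_add_cancel_left, neg_add_eq_sub, ← Nat.cast_sub (by omega),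
        ZMod.val_natCast_of_lt (by omega)]
      omega
    · have hle := hd _ hi _ hs
      rw [add_sub_cancel_left, ← Nat.cast_add, ZMod.val_natCast_of_lt (by omega)]
      omega
  obtain ⟨a, ha, hmin⟩ := Set.exists_min_image S (fun i => (i - s + (2 * k : ℕ)).val)
    (Set.toFinite S) ⟨s, hs⟩
  refine ⟨a, ha, fun i hi => ?_⟩
  have h1 := ZMod.val_sub (hmin i hi)
  rw [show i - s + ((2 * k : ℕ) : ZMod q) - (a - s + (2 * k : ℕ)) = i - a by ring] at h1
  have h2 := hoff i hi
  have h3 := cycleDist_add_natCast a (ZMod.val_lt (i - a)).le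
  rw [ZMod.natCast_zmod_val, add_sub_cancel] at h3
  have h4 := hd a ha i hi
  omega

end CycleDist

section Counting

lemma card_eq_of_double_count {ι V : Type*} [Fintype ι] [Fintype V] (r : ι → V → Prop)
    [∀ i x, Decidable (r i x)] {m c : ℕ}
    (hm : ∀ i, m ≤ (Finset.univ.filter fun x => r i x).card)
    (hc : ∀ x, (Finset.univ.filter fun i => r i x).card ≤ c)
    (h : c * Fintype.card V = Fintype.card ι * m) (x : V) :
    (Finset.univ.filter fun i => r i x).card = c := by
  have hdc := Finset.sum_card_bipartiteAbove_eq_sum_card_bipartiteBelow (s := Finset.univ)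
    (t := Finset.univ) r
  simp only [Finset.bipartiteAbove, Finset.bipartiteBelow] at hdc
  have h1 : Fintype.card ι * m ≤ ∑ i, (Finset.univ.filter fun x => r i x).card := by
    simpa using Finset.sum_le_sum fun i (_ : i ∈ Finset.univ) => hm i
  have h2 : ∑ x, (Finset.univ.filter fun i => r i x).card ≤ ∑ _x : V, c :=
    Finset.sum_le_sum fun x _ => hc x
  have h3 : ∑ x, (Finset.univ.filter fun i => r i x).card = ∑ _x : V, c := by
    refine le_antisymm h2 ?_
    rw [← hdc, Finset.sum_const, Finset.card_univ, smul_eq_mul, mul_comm]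
    omega
  exact (Finset.sum_eq_sum_iff_of_le fun x _ => hc x).1 h3 x (Finset.mem_univ x)

end Counting

section IsoCycle

variable {V : Type*} {G : SimpleGraph V} {q k : ℕ} {f : ZMod q → V}

lemma IsIsoCycle.neZero (hf : IsIsoCycle G q f) : NeZero q := ⟨by have := hf.1; omega⟩

lemma IsIsoCycle.dist_add_natCast [NeZero q] (hf : IsIsoCycle G q f) (i : ZMod q) {n : ℕ}
    (hn : n ≤ q) : G.dist (f i) (f (i + n)) = min n (q - n) := by
  rw [hf.2, cycleDist_add_natCast i hn]

lemma IsIsoCycle.adj_succ [NeZero q] (hf : IsIsoCycle G q f) (i : ZMod q) :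
    G.Adj (f i) (f (i + 1)) := by
  have h3 := hf.1
  have := hf.dist_add_natCast i (n := 1) (by omega)
  rw [Nat.cast_one] at this
  exact dist_eq_one_iff_adj.1 (by omega)

/-- The indices of cycle vertices at distance at most `k` from `x` lie on an arc. -/
lemma IsIsoCycle.exists_arc [NeZero q] (hc : G.Connected) (hf : IsIsoCycle G q f)
    (hq : 6 * k < q) (x : V) (hx : ∃ i, G.dist (f i) x ≤ k) :
    ∃ a, G.dist (f a) x ≤ k ∧ ∀ i, G.dist (f i) x ≤ k → (i - a).val ≤ 2 * k := by
  refine _root_.exists_arc (S := {i | G.dist (f i) x ≤ k}) hq hx fun i hi j hj => ?_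
  rw [← hf.2]
  have := hc.dist_triangle (u := f i) (v := x) (w := f j)
  simp only [Set.mem_ofPred_eq] at hi hj
  rw [dist_comm] at hj
  omega

lemma exists_part_of_odd [Fintype V] (hc : G.Connected) {d : ℕ} (hd : ∀ x, d ≤ ndeg G x)
    (hg : G.girth = 2 * k + 1) (hq : 6 * k + 3 < q)
    (hn : (2 * k + 1) * Nat.card V = q * mooreBound d (2 * k + 1)) (hf : IsIsoCycle G q f)
    (x : V) :
    ∃ a, ∀ n ≤ 2 * k, G.dist (f (a + (n : ℕ))) x ≤ k := by
  classical
  have := hf.neZero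
  have harc : ∀ x a, (∀ i, G.dist (f i) x ≤ k → (i - a).val ≤ 2 * k) →
      (Finset.univ.filter fun i => G.dist (f i) x ≤ k) ⊆
        (Finset.range (2 * k + 1)).image fun n : ℕ => a + (n : ZMod q) := by
    intro x a ha i hi
    have := ha i (by simpa using hi)
    exact Finset.mem_image.2 ⟨(i - a).val, by simp; omega, by simp⟩
  have hcard := card_eq_of_double_count (fun i x => G.dist (f i) x ≤ k)
    (fun i => mooreBound_le_card_disk hc hd hg (f i)) (c := 2 * k + 1) (fun x => by
      by_cases hx : ∃ i, G.dist (f i) x ≤ k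
      · obtain ⟨a, -, ha⟩ := hf.exists_arc hc (by omega) x hx
        simpa using (Finset.card_le_card (harc x a ha)).trans Finset.card_image_le
      · rw [Finset.filter_false_of_mem fun i _ hi => hx ⟨i, hi⟩]
        simp)
    (by rwa [ZMod.card, ← Nat.card_eq_fintype_card]) x
  have hx : ∃ i, G.dist (f i) x ≤ k := by
    obtain ⟨i, hi⟩ := Finset.card_pos.1 (by omega : 0 <
      (Finset.univ.filter fun i => G.dist (f i) x ≤ k).card)
    exact ⟨i, by simpa using hi⟩
  obtain ⟨a, -, ha⟩ := hf.exists_arc hc (by omega) x hx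
  have heq := Finset.eq_of_subset_of_card_le (harc x a ha)
    (Finset.card_image_le.trans (by simp [hcard]))
  refine ⟨a, fun n hn => ?_⟩
  have : a + (n : ZMod q) ∈ Finset.univ.filter fun i => G.dist (f i) x ≤ k := by
    rw [heq]
    exact Finset.mem_image.2 ⟨n, by simp; omega, rfl⟩
  simpa using this

lemma exists_part_of_even [Fintype V] (hc : G.Connected) {d : ℕ} (hd : ∀ x, d ≤ ndeg G x)
    (hg : G.girth = 2 * k + 2) (hq : 6 * k + 3 < q)
    (hn : (2 * k + 2) * Nat.card V = q * mooreBound d (2 * k + 2)) (hf : IsIsoCycle G q f)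
    (x : V) :
    ∃ a, G.dist (f a) x ≤ k ∧ G.dist (f (a + (2 * k : ℕ))) x ≤ k ∧
      ∀ n ≤ 2 * k, G.dist (f (a + (n : ℕ))) x ≤ k + 1 := by
  classical
  have := hf.neZero
  have harc : ∀ x a, (∀ i, G.dist (f i) x ≤ k → (i - a).val ≤ 2 * k) →
      (Finset.univ.filter fun i => G.dist (f i) x ≤ k ∨ G.dist (f (i + 1)) x ≤ k) ⊆
        (Finset.range (2 * k + 2)).image fun n : ℕ => a - 1 + (n : ZMod q) := by
    intro x a ha i hi
    rcases (by simpa using hi : G.dist (f i) x ≤ k ∨ G.dist (f (i + 1)) x ≤ k) with hi | hi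
    · have := ha _ hi
      exact Finset.mem_image.2 ⟨(i - a).val + 1, by simp; omega, by simp⟩
    · have := ha _ hi
      exact Finset.mem_image.2 ⟨(i + 1 - a).val, by simp; omega, by simp⟩
  have hcard := card_eq_of_double_count
    (fun i x => G.dist (f i) x ≤ k ∨ G.dist (f (i + 1)) x ≤ k)
    (fun i => mooreBound_le_card_edisk hc hd hg (hf.adj_succ i)) (c := 2 * k + 2) (fun x => by
      by_cases hx : ∃ i, G.dist (f i) x ≤ k
      · obtain ⟨a, -, ha⟩ := hf.exists_arc hc (by omega) x hx
        simpa using (Finset.card_le_card (harc x a ha)).trans Finset.card_image_le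
      · rw [Finset.filter_false_of_mem fun i _ hi => hx (hi.elim (⟨_, ·⟩) (⟨_, ·⟩))]
        simp)
    (by rwa [ZMod.card, ← Nat.card_eq_fintype_card]) x
  have hx : ∃ i, G.dist (f i) x ≤ k := by
    obtain ⟨i, hi⟩ := Finset.card_pos.1 (by omega : 0 <
      (Finset.univ.filter fun i => G.dist (f i) x ≤ k ∨ G.dist (f (i + 1)) x ≤ k).card)
    rcases (by simpa using hi : G.dist (f i) x ≤ k ∨ G.dist (f (i + 1)) x ≤ k) with hi | hi
    exacts [⟨_, hi⟩, ⟨_, hi⟩]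
  obtain ⟨a, hax, ha⟩ := hf.exists_arc hc (by omega) x hx
  have heq := Finset.eq_of_subset_of_card_le (harc x a ha)
    (Finset.card_image_le.trans (by simp [hcard]))
  have hmem : ∀ n ≤ 2 * k, G.dist (f (a + (n : ℕ))) x ≤ k ∨
      G.dist (f (a + (n : ℕ) + 1)) x ≤ k := by
    intro n hn
    have : a + (n : ZMod q) ∈
        Finset.univ.filter fun i => G.dist (f i) x ≤ k ∨ G.dist (f (i + 1)) x ≤ k := by
      rw [heq]
      exact Finset.mem_image.2 ⟨n + 1, by simp; omega, by push_cast; ring⟩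
    simpa using this
  refine ⟨a, hax, (hmem _ le_rfl).resolve_right fun h => ?_, fun n hn => ?_⟩
  · have := ha _ h
    rw [add_assoc, add_sub_cancel_left, ← Nat.cast_add_one,
      ZMod.val_natCast_of_lt (by omega)] at this
    omega
  · rcases hmem n hn with h | h
    · omega
    · have := dist_le_succ_of_adj hc x (hf.adj_succ (a + (n : ℕ))).symm
      rw [dist_comm (u := x), dist_comm (u := x)] at this
      omega

/-- Every vertex of an equatorial graph lies in a part induced by a longest isometric cycle, and
is close to the whole arc of the cycle spanned by the centres defining that part. -/
lemma IsEquatorial.exists_part {d g : ℕ} (hG : IsEquatorial G d g q) (hk : k = (g + 1) / 2 - 1)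
    (hf : IsIsoCycle G q f) (x : V) :
    ∃ i, x ∈ Lpart G k f i ∧ ∀ n ≤ 2 * k, G.dist (f (i - k + (n : ℕ))) x ≤ k + 1 := by
  obtain ⟨hfin, hc, hg, ⟨hd, -⟩, -, hq, hn⟩ := hG
  have := Fintype.ofFinite V
  rw [← hk] at hq
  suffices ∃ a, G.dist (f a) x ≤ k ∧ G.dist (f (a + (2 * k : ℕ))) x ≤ k ∧
      ∀ n ≤ 2 * k, G.dist (f (a + (n : ℕ))) x ≤ k + 1 by
    obtain ⟨a, h1, h2, h3⟩ := this
    refine ⟨a + k, ⟨?_, ?_⟩, ?_⟩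
    · simpa [disk] using h1
    · rw [add_assoc, ← two_mul]
      simpa [disk] using h2
    · simpa using h3
  rcases Nat.even_or_odd' g with ⟨m, rfl | rfl⟩
  · obtain rfl | hm := Nat.eq_zero_or_pos m
    · have : mooreBound d (2 * 0) ≠ 0 := by simp [mooreBound]
      have : q * mooreBound d (2 * 0) ≠ 0 := Nat.mul_ne_zero (by omega) this
      omega
    · obtain rfl : m = k + 1 := by omega
      exact exists_part_of_even hc hd hg hq hn hf x
  · obtain rfl : m = k := by omega
    obtain ⟨a, ha⟩ := exists_part_of_odd hc hd hg hq hn hf x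
    exact ⟨a, by simpa using ha 0 (by omega), ha _ le_rfl, fun n hn => (ha n hn).trans (by omega)⟩

end IsoCycle

section CycleMaps

variable {q : ℕ} [NeZero q] {σ : ZMod q → ZMod q}

/-- A nonexpansive self-map of a cycle preserving antipodality is injective. -/
lemma injective_of_cycleDist_le (hle : ∀ a b, cycleDist (σ a) (σ b) ≤ cycleDist a b)
    (hanti : ∀ a b, cycleDist a b = q / 2 → cycleDist (σ a) (σ b) = q / 2) :
    Function.Injective σ := by
  have key : ∀ (a : ZMod q) (n : ℕ), 2 * n ≤ q → σ a = σ (a + n) → n = 0 := by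
    intro a n hn h
    have h1 := hanti a (a + (q / 2 : ℕ)) (by rw [cycleDist_add_natCast a (by omega)]; omega)
    have h2 := hle (a + n) (a + (q / 2 : ℕ))
    rw [show a + ((q / 2 : ℕ) : ZMod q) = a + n + ((q / 2 - n : ℕ) : ZMod q) by
      rw [add_assoc, ← Nat.cast_add, Nat.add_sub_cancel' (by omega)]] at h1 h2
    rw [cycleDist_add_natCast _ (by omega)] at h2
    rw [h] at h1
    omega
  intro a b h
  obtain ⟨n, hn, -, rfl | rfl⟩ := exists_natCast_eq_cycleDist a b
  · simp [key _ n hn h]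
  · simp [key _ n hn h.symm]

/-- An injective nonexpansive self-map of a cycle is a rotation or a reflection. -/
lemma exists_rotation_or_reflection (hq : 3 ≤ q) (hinj : Function.Injective σ)
    (hle : ∀ a b, cycleDist (σ a) (σ b) ≤ cycleDist a b) :
    (∀ a b, σ (a + b) = σ a + b) ∨ (∀ a b, σ (a + b) = σ a - b) := by
  have hcast : ∀ n : ℕ, 0 < n → n < q → (n : ZMod q) ≠ 0 := by
    intro n hn hnq h
    have := ZMod.val_natCast_of_lt hnq
    rw [h, ZMod.val_zero] at this
    omega
  have hstep : ∀ a, σ (a + 1) = σ a + 1 ∨ σ (a + 1) = σ a - 1 := by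
    intro a
    obtain ⟨n, -, hn, h⟩ := exists_natCast_eq_cycleDist (σ a) (σ (a + 1))
    have h1 := hle a (a + 1)
    have h2 := cycleDist_add_natCast a (n := 1) (by omega)
    rw [Nat.cast_one] at h2
    have h3 : n ≠ 0 := by
      rintro rfl
      have h4 := hinj (cycleDist_eq_zero.1 hn)
      exact hcast 1 one_pos (by omega) (by simpa using h4.symm)
    obtain rfl : n = 1 := by omega
    rw [Nat.cast_one] at h
    exact h.imp_right fun h => eq_sub_of_add_eq h.symm
  obtain ⟨ε, hε, h0⟩ : ∃ ε : ZMod q, (ε = 1 ∨ ε = -1) ∧ σ (0 + 1) = σ 0 + ε := by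
    rcases hstep 0 with h | h
    exacts [⟨1, .inl rfl, h⟩, ⟨-1, .inr rfl, by rw [h, sub_eq_add_neg]⟩]
  have hnat : ∀ n : ℕ, σ ((n : ZMod q) + 1) = σ n + ε := by
    intro n
    induction n with
    | zero => simpa using h0
    | succ n ih =>
      push_cast
      have hne : σ ((n : ZMod q) + 1 + 1) ≠ σ n := fun h => by
        have h4 := hinj h
        rw [add_assoc, add_eq_left] at h4
        exact hcast 2 two_pos (by omega) (by rw [← h4]; norm_num)
      rcases hε with rfl | rfl <;> rcases hstep ((n : ZMod q) + 1) with h | h <;> rw [ih] at h ⊢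
      · exact h
      · exact absurd (by rw [h]; ring) hne
      · exact absurd (by rw [h]; ring) hne
      · rw [h, sub_eq_add_neg]
  have hlin : ∀ a (n : ℕ), σ (a + n) = σ a + ε * n := by
    intro a n
    induction n with
    | zero => simp
    | succ n ih =>
      have := hnat (a + n).val
      rw [ZMod.natCast_zmod_val, ih] at this
      push_cast
      rw [← add_assoc, this]
      ring
  have hall : ∀ a b, σ (a + b) = σ a + ε * b := fun a b => by
    simpa using hlin a b.val
  rcases hε with rfl | rfl
  · exact .inl fun a b => by rw [hall, one_mul]
  · exact .inr fun a b => by rw [hall]; ring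

end CycleMaps

section Parts

variable {V : Type*} {G : SimpleGraph V} {q k : ℕ} {f : ZMod q → V}

lemma mem_Lpart {i : ZMod q} {x : V} :
    x ∈ Lpart G k f i ↔ G.dist (f (i - k)) x ≤ k ∧ G.dist (f (i + k)) x ≤ k := Iff.rfl

lemma IsIsoCycle.cycleDist_le_dist_of_dist_le_one (hc : G.Connected) (hf : IsIsoCycle G q f)
    (hq : 6 * k + 3 < q) {i j : ZMod q} {x y : V} (hx : x ∈ Lpart G k f i)
    (hy : y ∈ Lpart G k f j) (hxy : G.dist x y ≤ 1) : cycleDist i j ≤ G.dist x y := by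
  have := hf.neZero
  have key : ∀ (i : ZMod q) (n : ℕ) (x y : V), 2 * n ≤ q → x ∈ Lpart G k f i →
      y ∈ Lpart G k f (i + n) → G.dist x y ≤ 1 → n ≤ G.dist x y := by
    intro i n x y hn hx hy hxy
    rw [mem_Lpart] at hx hy
    have h1 := hf.dist_add_natCast (i + k) (n := n) (by omega)
    have h2 := hf.dist_add_natCast (i - k) (n := n + 2 * k) (by omega)
    rw [add_right_comm] at h1
    rw [show i - k + ((n + 2 * k : ℕ) : ZMod q) = i + n + k by push_cast; ring] at h2
    have t1 := hc.dist_triangle (u := f (i + k)) (v := x) (w := f (i + n + k))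
    have t2 := hc.dist_triangle (u := f (i - k)) (v := x) (w := f (i + n + k))
    have t3 := hc.dist_triangle (u := x) (v := y) (w := f (i + n + k))
    rw [dist_comm (u := y)] at t3
    omega
  obtain ⟨n, hn, hd, rfl | rfl⟩ := exists_natCast_eq_cycleDist i j
  · rw [hd]
    exact key i n x y hn hx hy hxy
  · rw [hd]
    rw [SimpleGraph.dist_comm] at hxy ⊢
    exact key j n y x hn hy hx hxy

/-- Distinct parts are disjoint. -/
lemma IsIsoCycle.part_unique (hc : G.Connected) (hf : IsIsoCycle G q f)
    (hq : 6 * k + 3 < q) {i j : ZMod q} {x : V} (hi : x ∈ Lpart G k f i)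
    (hj : x ∈ Lpart G k f j) : i = j := by
  have := hf.neZero
  have := hf.cycleDist_le_dist_of_dist_le_one hc hq hi hj (by simp)
  exact cycleDist_eq_zero.1 (by simpa using this)

lemma IsIsoCycle.self_mem_Lpart [NeZero q] (hf : IsIsoCycle G q f) (hq : 6 * k + 3 < q)
    (i : ZMod q) : f i ∈ Lpart G k f i := by
  have h1 := hf.dist_add_natCast (i - k) (n := k) (by omega)
  have h2 := hf.dist_add_natCast i (n := k) (by omega)
  rw [sub_add_cancel] at h1
  rw [dist_comm] at h2
  exact mem_Lpart.2 ⟨by omega, by omega⟩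

lemma IsIsoCycle.cycleDist_le_dist (hc : G.Connected) (hf : IsIsoCycle G q f)
    (hq : 6 * k + 3 < q) {φ : V → ZMod q} (hφ : ∀ x, x ∈ Lpart G k f (φ x)) (x y : V) :
    cycleDist (φ x) (φ y) ≤ G.dist x y := by
  have := hf.neZero
  obtain ⟨p, hp⟩ := hc.exists_walk_length_eq_dist x y
  rw [← hp]
  clear hp
  induction p with
  | nil => simp [cycleDist]
  | @cons u v w h p ih =>
    have h1 := dist_eq_one_iff_adj.2 h
    have h2 := hf.cycleDist_le_dist_of_dist_le_one hc hq (hφ u) (hφ v) h1.le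
    have h3 := hc.dist_triangle (u := f (φ u)) (v := f (φ v)) (w := f (φ w))
    rw [hf.2, hf.2, hf.2] at h3
    rw [Walk.length_cons]
    omega

lemma IsIsoCycle.dist_le_max (hc : G.Connected) (hf : IsIsoCycle G q f) {φ : V → ZMod q}
    (hφ : ∀ x, x ∈ Lpart G k f (φ x))
    (harc : ∀ x, ∀ n ≤ 2 * k, G.dist (f (φ x - k + (n : ℕ))) x ≤ k + 1) (x y : V) :
    G.dist x y ≤ max (2 * k + 1) (cycleDist (φ x) (φ y)) := by
  have := hf.neZero
  have key : ∀ (x y : V) (n : ℕ), 2 * n ≤ q → φ y = φ x + n → G.dist x y ≤ max (2 * k + 1) n := by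
    intro x y n hn h
    have hy := (mem_Lpart.1 (hφ y)).1
    have hx := (mem_Lpart.1 (hφ x)).2
    have t1 := hc.dist_triangle (u := x) (v := f (φ y - k)) (w := y)
    rw [dist_comm (u := x) (v := f (φ y - k))] at t1
    rcases le_or_gt n (2 * k) with hle | hgt
    · have h1 := harc x n hle
      rw [show φ x - k + (n : ZMod q) = φ y - k by rw [h]; ring] at h1
      omega
    · have h1 := hf.dist_add_natCast (φ x + k) (n := n - 2 * k) (by omega)
      rw [show φ x + k + ((n - 2 * k : ℕ) : ZMod q) = φ y - k by
        rw [h, Nat.cast_sub hgt.le]; push_cast; ring, dist_comm] at h1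
      have t2 := hc.dist_triangle (u := f (φ y - k)) (v := f (φ x + k)) (w := x)
      omega
  obtain ⟨n, hn, hd, h | h⟩ := exists_natCast_eq_cycleDist (φ x) (φ y)
  · exact hd ▸ key x y n hn h
  · rw [dist_comm]
    exact hd ▸ key y x n hn h

end Parts

/-- Proposition 5.9: every isometric `q`-cycle of an equatorial graph induces the same
partition (the families of parts coincide as set partitions, up to relabeling). -/
theorem stmt_14 {V : Type*} (G : SimpleGraph V) (δ g q k : ℕ)
    (hG : IsEquatorial G δ g q) (hk : k = (g + 1) / 2 - 1)
    (f : ZMod q → V) (hf : IsIsoCycle G q f)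
    (h : ZMod q → V) (hh : IsIsoCycle G q h) :
    {S : Set V | ∃ i : ZMod q, S = Lpart G k f i} =
      {S : Set V | ∃ i : ZMod q, S = Lpart G k h i} := by
  have := hf.neZero
  have hc : G.Connected := hG.2.1
  have hq : 6 * k + 3 < q := hk ▸ hG.2.2.2.2.2.1
  choose φ hφ harc using hG.exists_part hk hf
  have hlip := hf.cycleDist_le_dist hc hq hφ
  have hle : ∀ a b, cycleDist (φ (h a)) (φ (h b)) ≤ cycleDist a b := fun a b =>
    hh.2 a b ▸ hlip (h a) (h b)
  have hanti : ∀ a b, cycleDist a b = q / 2 → cycleDist (φ (h a)) (φ (h b)) = q / 2 := by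
    intro a b hab
    have h1 := hf.dist_le_max hc hφ harc (h a) (h b)
    have h2 := hle a b
    rw [hh.2] at h1
    omega
  have hinj : Function.Injective fun a => φ (h a) := injective_of_cycleDist_le hle hanti
  have hsub : ∀ a, Lpart G k h a ⊆ Lpart G k f (φ (h a)) := by
    intro a x hx
    rw [mem_Lpart] at hx
    have h1 := (hlip _ _).trans hx.1
    have h2 := (hlip _ _).trans hx.2
    have hmem : f (φ x) ∈ Lpart G k f (φ (h a)) := by
      rw [mem_Lpart, hf.2, hf.2]
      rcases exists_rotation_or_reflection hf.1 hinj hle with hr | hr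
      · have e1 := hr a (-k)
        have e2 := hr a k
        simp only [← sub_eq_add_neg] at e1
        exact ⟨e1 ▸ h1, e2 ▸ h2⟩
      · have e1 := hr a (-k)
        have e2 := hr a k
        simp only [← sub_eq_add_neg, sub_neg_eq_add] at e1
        exact ⟨e2 ▸ h2, e1 ▸ h1⟩
    rw [hf.part_unique hc hq hmem (hf.self_mem_Lpart hq _)]
    exact hφ x
  have heq : ∀ a, Lpart G k h a = Lpart G k f (φ (h a)) := by
    intro a
    refine (hsub a).antisymm fun x hx => ?_
    obtain ⟨b, hb, -⟩ := hG.exists_part hk hh x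
    exact hinj (hf.part_unique hc hq hx (hsub b hb)) ▸ hb
  ext S
  constructor
  · rintro ⟨i, rfl⟩
    obtain ⟨a, rfl⟩ := (Finite.injective_iff_surjective.1 hinj) i
    exact ⟨a, (heq a).symm⟩
  · rintro ⟨a, rfl⟩
    exact ⟨φ (h a), heq a⟩
end
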